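/- For all n ≥ 1, the number of rooted labeled forests on [n] avoiding both patterns 132 and 231 equals ∑_{k=1}^{n} k!·c(n,k), where c(n,k) is the unsigned Stirling number of the first kind. -/

import Mathlib

/-- A rooted labeled forest on `[n]`, encoded as a parent function
`p : Fin n → Option (Fin n)` (`p v = none` means `v` is a root).
Acyclicity is expressed by the existence of a depth function strictly
decreasing from each vertex to its parent. -/
def IsForest {n : ℕ} (p : Fin n → Option (Fin n)) : Prop :=
  ∃ d : Fin n → ℕ, ∀ v w : Fin n, p v = some w → d w < d v

/-- `StrictAnc p a b` means `a` is a strict ancestor of `b` in the forest `p`. -/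
def StrictAnc {n : ℕ} (p : Fin n → Option (Fin n)) (a b : Fin n) : Prop :=
  Relation.TransGen (fun x y : Fin n => p y = some x) a b

/-- The forest `p` contains the pattern `σ` (given in one-line notation):
there is a chain of vertices along some root-to-vertex path whose labels
are order-isomorphic to `σ`. -/
def ForestContains {n : ℕ} (p : Fin n → Option (Fin n)) (σ : List ℕ) : Prop :=
  ∃ u : Fin σ.length → Fin n,
    (∀ i j : Fin σ.length, i < j → StrictAnc p (u i) (u j)) ∧
    (∀ i j : Fin σ.length, σ.get i < σ.get j ↔ u i < u j)

/-- The forest `p` avoids the pattern `σ`. -/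
def ForestAvoids {n : ℕ} (p : Fin n → Option (Fin n)) (σ : List ℕ) : Prop :=
  ¬ ForestContains p σ

/-- Number of cycles (including fixed points) in the cycle decomposition of a
permutation. -/
def permNumCycles {n : ℕ} (π : Equiv.Perm (Fin n)) : ℕ :=
  π.cycleType.card + (Finset.univ.filter fun x => π x = x).card

/-- Unsigned Stirling number of the first kind: the number of permutations of
`[n]` with exactly `k` cycles. -/
noncomputable def stirlingFirst (n k : ℕ) : ℕ :=
  Nat.card {π : Equiv.Perm (Fin n) // permNumCycles π = k}

/-- Stirling number of the second kind: the number of partitions of `[n]`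
into `k` nonempty subsets. -/
noncomputable def stirlingSecond (n k : ℕ) : ℕ :=
  Nat.card {P : Finpartition (Finset.univ : Finset (Fin n)) // P.parts.card = k}

/-- The Bell number: the number of set partitions of `[n]`. -/
noncomputable def bellNumber (n : ℕ) : ℕ :=
  Nat.card (Finpartition (Finset.univ : Finset (Fin n)))

/-- A vertex is a top-down maximum if it is larger than all of its ancestors. -/
def IsTopDownMax {n : ℕ} (p : Fin n → Option (Fin n)) (v : Fin n) : Prop :=
  ∀ u : Fin n, StrictAnc p u v → u < v

section CycleCount

open Equiv Equiv.Perm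

theorem permNumCycles_add_sum_cycleType {n : ℕ} (π : Perm (Fin n)) :
    permNumCycles π + π.cycleType.sum = π.cycleType.card + n := by
  have hfix : (Finset.univ.filter fun x => π x = x) = π.supportᶜ := by
    ext x
    simp
  have hcard := Finset.card_compl_add_card π.support
  rw [Fintype.card_fin] at hcard
  rw [permNumCycles, hfix, sum_cycleType]
  omega

theorem permNumCycles_le {n : ℕ} (π : Perm (Fin n)) : permNumCycles π ≤ n := by
  have h := permNumCycles_add_sum_cycleType π
  have hle : π.cycleType.card ≤ π.cycleType.sum := by
    simpa using Multiset.card_nsmul_le_sum (s := π.cycleType) (a := 1)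
      fun x hx => (one_lt_of_mem_cycleType hx).le
  omega

theorem permNumCycles_pos {n : ℕ} (hn : 1 ≤ n) (π : Perm (Fin n)) : 1 ≤ permNumCycles π := by
  have h := permNumCycles_add_sum_cycleType π
  rcases Nat.eq_zero_or_pos π.cycleType.card with h0 | h0
  · rw [Multiset.card_eq_zero] at h0
    simp only [h0, Multiset.sum_zero, Multiset.card_zero] at h
    omega
  · rw [permNumCycles]
    omega

theorem permNumCycles_swap_mul {n : ℕ} (σ : Perm (Fin n)) {x : Fin n} (hx : σ x ≠ x) :
    permNumCycles (swap x (σ x) * σ) = permNumCycles σ + 1 := by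
  set c := σ.cycleOf x
  have hcx : c x = σ x := cycleOf_apply_self σ x
  have hcyc : c.IsCycle := isCycle_cycleOf σ hx
  have hmem : c ∈ σ.cycleFactorsFinset :=
    cycleOf_mem_cycleFactorsFinset_iff.2 (mem_support.2 hx)
  have hdisj : (σ * c⁻¹).Disjoint c := disjoint_mul_inv_of_mem_cycleFactorsFinset hmem
  have hσ : σ = c * (σ * c⁻¹) := by rw [hdisj.commute.symm.eq, inv_mul_cancel_right]
  have hxc : c x ≠ x := hcx ▸ hx
  have hdisj' : (swap x (c x) * c).Disjoint (σ * c⁻¹) := by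
    refine disjoint_iff_disjoint_support.2 (Finset.disjoint_of_subset_left ?_
      (disjoint_iff_disjoint_support.1 hdisj.symm))
    intro y hy
    exact (mem_support_swap_mul_imp_mem_support_ne hy).1
  have hprod : swap x (σ x) * σ = swap x (c x) * c * (σ * c⁻¹) := by
    rw [mul_assoc, ← hσ, hcx]
  have h₁ := permNumCycles_add_sum_cycleType σ
  have h₂ := permNumCycles_add_sum_cycleType (swap x (σ x) * σ)
  have hσt : σ.cycleType = c.cycleType + (σ * c⁻¹).cycleType := by
    rw [← hdisj.symm.cycleType_mul, ← hσ]
  rw [hprod, hdisj'.cycleType_mul, ← hprod] at h₂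
  rw [hσt, hcyc.cycleType] at h₁
  simp only [Multiset.sum_add, Multiset.card_add, Multiset.sum_singleton,
    Multiset.card_singleton] at h₁ h₂
  by_cases hcc : c (c x) = x
  · have hswap : c = swap x (c x) := hcyc.eq_swap_of_apply_apply_eq_self hxc hcc
    have hone : swap x (c x) * c = 1 := by
      nth_rewrite 2 [hswap]
      exact swap_mul_self _ _
    have hsupp : c.support.card = 2 := by
      rw [hswap]
      exact card_support_swap hxc.symm
    simp only [hone, cycleType_one, Multiset.sum_zero, Multiset.card_zero] at h₂
    omega
  · have hsupp : (swap x (c x) * c).support.card + 1 = c.support.card := by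
      rw [support_swap_mul_eq _ _ hcc, Finset.sdiff_singleton_eq_erase]
      exact Finset.card_erase_add_one (mem_support.2 hxc)
    simp only [(hcyc.swap_mul hxc hcc).cycleType, Multiset.sum_singleton,
      Multiset.card_singleton] at h₂
    omega

theorem decomposeFin_symm_eq_swap_mul {n : ℕ} (a : Fin (n + 1)) (e : Perm (Fin n)) :
    decomposeFin.symm (a, e) = swap 0 a * decomposeFin.symm (0, e) := by
  ext x
  refine Fin.cases ?_ (fun i => ?_) x <;> simp

theorem permNumCycles_decomposeFin_symm_zero {n : ℕ} (e : Perm (Fin n)) :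
    permNumCycles (decomposeFin.symm (0, e)) = permNumCycles e + 1 := by
  have hext : decomposeFin.symm (0, e) = e.extendDomain (finSuccAboveEquiv (0 : Fin (n + 1))) := by
    ext x
    refine Fin.cases ?_ (fun i => ?_) x
    · rw [extendDomain_apply_not_subtype _ _ (by simp)]
      simp
    · have := extendDomain_apply_image e (finSuccAboveEquiv (0 : Fin (n + 1))) i
      simp only [finSuccAboveEquiv_apply, Fin.zero_succAbove] at this
      simp [this]
  have h₁ := permNumCycles_add_sum_cycleType e
  have h₂ := permNumCycles_add_sum_cycleType (decomposeFin.symm (0, e))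
  rw [hext, cycleType_extendDomain, ← hext] at h₂
  omega

theorem permNumCycles_decomposeFin_symm_succ {n : ℕ} (i : Fin n) (e : Perm (Fin n)) :
    permNumCycles (decomposeFin.symm (i.succ, e)) = permNumCycles e := by
  have h := permNumCycles_swap_mul (decomposeFin.symm (i.succ, e)) (x := 0) (by simp)
  rw [decomposeFin_symm_apply_zero] at h
  nth_rewrite 1 [decomposeFin_symm_eq_swap_mul] at h
  rw [swap_mul_self_mul, permNumCycles_decomposeFin_symm_zero] at h
  omega

theorem sum_ascFactorial_permNumCycles_succ (n t : ℕ) :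
    ∑ π : Perm (Fin (n + 1)), t.ascFactorial (permNumCycles π) =
      n * ∑ π : Perm (Fin n), t.ascFactorial (permNumCycles π) +
        t * ∑ π : Perm (Fin n), (t + 1).ascFactorial (permNumCycles π) := by
  rw [← decomposeFin.symm.sum_comp, Fintype.sum_prod_type, Fin.sum_univ_succ]
  simp only [permNumCycles_decomposeFin_symm_zero, permNumCycles_decomposeFin_symm_succ,
    Finset.sum_const, Finset.card_univ, Fintype.card_fin, smul_eq_mul]
  rw [add_comm, Finset.mul_sum Finset.univ _ t]
  congr 1
  refine Finset.sum_congr rfl fun π _ => ?_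
  rw [Nat.ascFactorial_succ, ← Nat.succ_ascFactorial]

theorem sum_factorial_permNumCycles {n : ℕ} (hn : 1 ≤ n) :
    ∑ π : Perm (Fin n), (permNumCycles π).factorial =
      ∑ k ∈ Finset.Icc 1 n, k.factorial * stirlingFirst n k := by
  rw [← Finset.sum_fiberwise_of_maps_to (s := Finset.univ) (t := Finset.Icc 1 n)
    (g := fun π : Perm (Fin n) => permNumCycles π)
    fun π _ => Finset.mem_Icc.2 ⟨permNumCycles_pos hn π, permNumCycles_le π⟩]
  refine Finset.sum_congr rfl fun k _ => ?_
  rw [stirlingFirst, Nat.card_eq_fintype_card, Fintype.card_subtype,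
    Finset.sum_congr rfl fun π hπ => by rw [(Finset.mem_filter.1 hπ).2], Finset.sum_const,
    smul_eq_mul, mul_comm]

end CycleCount

section Forests

variable {n : ℕ}

/-- No vertex is larger than both its parent and one of its children. -/
def NoLocalPeak (p : Fin n → Option (Fin n)) : Prop :=
  ∀ a b c : Fin n, p c = some b → p b = some a → a < b → b ≤ c

/-- A forest all of whose root-to-vertex paths first decrease and then increase. -/
def IsValleyForest (p : Fin n → Option (Fin n)) : Prop :=
  IsForest p ∧ NoLocalPeak p

theorem IsForest.ne_of_strictAnc {p : Fin n → Option (Fin n)} (hp : IsForest p) {a b : Fin n}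
    (h : StrictAnc p a b) : a ≠ b := by
  obtain ⟨d, hd⟩ := hp
  have hlt : d a < d b := by
    induction h with
    | single h => exact hd _ _ h
    | tail _ h ih => exact ih.trans (hd _ _ h)
  rintro rfl
  exact hlt.false

theorem IsForest.ne_of_parent {p : Fin n → Option (Fin n)} (hp : IsForest p) {a b : Fin n}
    (h : p b = some a) : a ≠ b :=
  hp.ne_of_strictAnc (Relation.TransGen.single h)

theorem NoLocalPeak.lt_of_strictAnc {p : Fin n → Option (Fin n)} (hp : IsForest p)
    (hl : NoLocalPeak p) {a b c : Fin n} (hab : p b = some a) (hlt : a < b)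
    (hbc : StrictAnc p b c) : b < c := by
  suffices h : ∃ x, p c = some x ∧ x < c ∧ b ≤ x by
    obtain ⟨x, -, h₁, h₂⟩ := h
    exact h₂.trans_lt h₁
  induction hbc with
  | single h => exact ⟨b, h, lt_of_le_of_ne (hl a b _ h hab hlt) (hp.ne_of_parent h), le_rfl⟩
  | tail _ h ih =>
    obtain ⟨x, hx, hxy, hbx⟩ := ih
    exact ⟨_, h, lt_of_le_of_ne (hl _ _ _ h hx hxy) (hp.ne_of_parent h), hbx.trans hxy.le⟩

theorem NoLocalPeak.exists_parent_lt {p : Fin n → Option (Fin n)} (hp : IsForest p)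
    (hl : NoLocalPeak p) {a b : Fin n} (hab : StrictAnc p a b) (hlt : a < b) :
    ∃ x, p b = some x ∧ x < b := by
  induction hab with
  | single h => exact ⟨a, h, hlt⟩
  | @tail y z _ h ih =>
    rcases lt_or_ge y z with hyz | hzy
    · exact ⟨y, h, hyz⟩
    · obtain ⟨x, hx, hxy⟩ := ih (hlt.trans_le hzy)
      exact ⟨y, h, lt_of_le_of_ne (hl _ _ _ h hx hxy) (hp.ne_of_parent h)⟩

theorem forestContains_three_iff {p : Fin n → Option (Fin n)} (x y z : ℕ) :
    ForestContains p [x, y, z] ↔ ∃ a b c : Fin n, StrictAnc p a b ∧ StrictAnc p b c ∧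
      ((x < y ↔ a < b) ∧ (y < x ↔ b < a)) ∧ ((y < z ↔ b < c) ∧ (z < y ↔ c < b)) ∧
      ((x < z ↔ a < c) ∧ (z < x ↔ c < a)) := by
  constructor
  · rintro ⟨u, hu, hσ⟩
    exact ⟨u 0, u 1, u 2, hu 0 1 (by decide : (0 : Fin 3) < 1),
      hu 1 2 (by decide : (1 : Fin 3) < 2), ⟨hσ 0 1, hσ 1 0⟩,
      ⟨hσ 1 2, hσ 2 1⟩, ⟨hσ 0 2, hσ 2 0⟩⟩
  · rintro ⟨a, b, c, hab, hbc, h₁, h₂, h₃⟩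
    refine ⟨![a, b, c], ?_, ?_⟩
    · suffices h : ∀ i j : Fin 3, i < j → StrictAnc p (![a, b, c] i) (![a, b, c] j) from h
      intro i j hij
      fin_cases i <;> fin_cases j <;> first
        | exact absurd hij (by decide)
        | exact hab
        | exact hbc
        | exact hab.trans hbc
    · intro i j
      change Fin 3 at i j
      fin_cases i <;> fin_cases j <;> first
        | exact h₁.1
        | exact h₁.2
        | exact h₂.1
        | exact h₂.2
        | exact h₃.1
        | exact h₃.2
        | exact iff_of_false (lt_irrefl _) (lt_irrefl _)

theorem isValleyForest_iff (p : Fin n → Option (Fin n)) :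
    IsValleyForest p ↔
      IsForest p ∧ ForestAvoids p [1, 3, 2] ∧ ForestAvoids p [2, 3, 1] := by
  refine and_congr_right fun hp => ?_
  simp only [ForestAvoids, forestContains_three_iff]
  constructor
  · intro hl
    have key : ∀ a b c : Fin n, StrictAnc p a b → StrictAnc p b c → a < b → c < b → False := by
      intro a b c hab hbc hlt hcb
      obtain ⟨x, hx, hxb⟩ := hl.exists_parent_lt hp hab hlt
      exact (hl.lt_of_strictAnc hp hx hxb hbc).asymm hcb
    constructor <;> rintro ⟨a, b, c, hab, hbc, ⟨h₁, -⟩, ⟨-, h₂⟩, -⟩ <;>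
      exact key a b c hab hbc (h₁.1 (by norm_num)) (h₂.1 (by norm_num))
  · rintro ⟨h₁, h₂⟩ a b c hbc hab hlt
    by_contra! hcb
    have hab' : StrictAnc p a b := Relation.TransGen.single hab
    have hbc' : StrictAnc p b c := Relation.TransGen.single hbc
    have hac : a ≠ c := hp.ne_of_strictAnc (hab'.trans hbc')
    rcases lt_or_gt_of_ne hac with hac | hac
    · exact h₁ ⟨a, b, c, hab', hbc', by simp [hlt, hlt.le], by simp [hcb, hcb.le],
        by simp [hac, hac.le]⟩
    · exact h₂ ⟨a, b, c, hab', hbc', by simp [hlt, hlt.le], by simp [hcb, hcb.le],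
        by simp [hac, hac.le]⟩

/-- The roots of a forest. -/
def rootSet (p : Fin n → Option (Fin n)) : Finset (Fin n) :=
  Finset.univ.filter fun v => p v = none

/-- Attach a new largest vertex as a child of `w`. -/
def attachLeaf (q : Fin n → Option (Fin n)) (w : Fin n) : Fin (n + 1) → Option (Fin (n + 1)) :=
  Fin.lastCases (some w.castSucc) fun v => (q v).map Fin.castSucc

/-- Attach a new largest vertex as a root, with the vertices in `S` as its children. -/
def attachRoot (q : Fin n → Option (Fin n)) (S : Finset (Fin n)) :
    Fin (n + 1) → Option (Fin (n + 1)) :=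
  Fin.lastCases none fun v => if v ∈ S then some (Fin.last n) else (q v).map Fin.castSucc

/-- Delete the largest vertex; its children become roots. -/
def deleteLast (p : Fin (n + 1) → Option (Fin (n + 1))) (v : Fin n) : Option (Fin n) :=
  (p v.castSucc).bind (Fin.lastCases none some)

@[simp]
theorem attachLeaf_last (q : Fin n → Option (Fin n)) (w : Fin n) :
    attachLeaf q w (Fin.last n) = some w.castSucc := by
  simp [attachLeaf]

@[simp]
theorem attachLeaf_castSucc (q : Fin n → Option (Fin n)) (w v : Fin n) :
    attachLeaf q w v.castSucc = (q v).map Fin.castSucc := by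
  simp [attachLeaf]

@[simp]
theorem attachRoot_last (q : Fin n → Option (Fin n)) (S : Finset (Fin n)) :
    attachRoot q S (Fin.last n) = none := by
  simp [attachRoot]

@[simp]
theorem attachRoot_castSucc (q : Fin n → Option (Fin n)) (S : Finset (Fin n)) (v : Fin n) :
    attachRoot q S v.castSucc =
      if v ∈ S then some (Fin.last n) else (q v).map Fin.castSucc := by
  simp [attachRoot]

theorem deleteLast_eq_some {p : Fin (n + 1) → Option (Fin (n + 1))} {v w : Fin n} :
    deleteLast p v = some w ↔ p v.castSucc = some w.castSucc := by
  rw [deleteLast]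
  rcases p v.castSucc with - | u
  · simp
  · refine Fin.lastCases ?_ (fun u => ?_) u <;> simp [(Fin.castSucc_ne_last _).symm]

theorem deleteLast_eq_none {p : Fin (n + 1) → Option (Fin (n + 1))} {v : Fin n} :
    deleteLast p v = none ↔ p v.castSucc = none ∨ p v.castSucc = some (Fin.last n) := by
  rw [deleteLast]
  rcases p v.castSucc with - | u
  · simp
  · refine Fin.lastCases ?_ (fun u => ?_) u <;> simp

theorem deleteLast_attachLeaf (q : Fin n → Option (Fin n)) (w : Fin n) :
    deleteLast (attachLeaf q w) = q := by
  ext v u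
  rw [deleteLast_eq_some]
  simp

theorem deleteLast_attachRoot {q : Fin n → Option (Fin n)} {S : Finset (Fin n)}
    (hS : S ⊆ rootSet q) : deleteLast (attachRoot q S) = q := by
  ext v u
  rw [deleteLast_eq_some, attachRoot_castSucc]
  by_cases hv : v ∈ S
  · have hq : q v = none := (Finset.mem_filter.1 (hS hv)).2
    simp [hv, hq, (Fin.castSucc_ne_last _).symm]
  · simp [hv]

theorem IsValleyForest.deleteLast {p : Fin (n + 1) → Option (Fin (n + 1))}
    (hp : IsValleyForest p) : IsValleyForest (deleteLast p) := by
  obtain ⟨⟨d, hd⟩, hl⟩ := hp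
  refine ⟨⟨fun v => d v.castSucc, fun v w h => hd _ _ (deleteLast_eq_some.1 h)⟩, ?_⟩
  intro a b c hbc hab hlt
  exact hl a.castSucc b.castSucc c.castSucc (deleteLast_eq_some.1 hbc)
    (deleteLast_eq_some.1 hab) hlt

theorem IsValleyForest.attachLeaf {q : Fin n → Option (Fin n)} (hq : IsValleyForest q)
    (w : Fin n) : IsValleyForest (attachLeaf q w) := by
  obtain ⟨⟨d, hd⟩, hl⟩ := hq
  refine ⟨⟨Fin.lastCases (d w + 1) d, ?_⟩, ?_⟩
  · intro v
    refine Fin.lastCases ?_ (fun v => ?_) v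
    · intro u hu
      obtain rfl : w.castSucc = u := by simpa using hu
      simp
    · intro u hu
      obtain ⟨u, huv, rfl⟩ : ∃ x, q v = some x ∧ x.castSucc = u := by simpa using hu
      simpa using hd v u huv
  · intro a b c
    refine Fin.lastCases ?_ (fun c => ?_) c
    · exact fun _ _ _ => Fin.le_last b
    · intro hbc hab hlt
      obtain ⟨b, hcb, rfl⟩ : ∃ x, q c = some x ∧ x.castSucc = b := by simpa using hbc
      obtain ⟨a, hba, rfl⟩ : ∃ x, q b = some x ∧ x.castSucc = a := by simpa using hab
      exact hl a b c hcb hba hlt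

theorem IsValleyForest.attachRoot {q : Fin n → Option (Fin n)} (hq : IsValleyForest q)
    (S : Finset (Fin n)) : IsValleyForest (attachRoot q S) := by
  obtain ⟨⟨d, hd⟩, hl⟩ := hq
  refine ⟨⟨Fin.lastCases 0 fun v => d v + 1, ?_⟩, ?_⟩
  · intro v
    refine Fin.lastCases ?_ (fun v => ?_) v
    · simp
    · intro u hu
      rw [attachRoot_castSucc] at hu
      split_ifs at hu with hv
      · obtain rfl : Fin.last n = u := by simpa using hu
        simp
      · obtain ⟨u, huv, rfl⟩ : ∃ x, q v = some x ∧ x.castSucc = u := by simpa using hu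
        simpa using hd v u huv
  · intro a b c
    refine Fin.lastCases ?_ (fun c => ?_) c
    · simp
    · intro hbc hab hlt
      rw [attachRoot_castSucc] at hbc
      split_ifs at hbc
      · obtain rfl : Fin.last n = b := by simpa using hbc
        simp at hab
      · obtain ⟨b, hcb, rfl⟩ : ∃ x, q c = some x ∧ x.castSucc = b := by simpa using hbc
        rw [attachRoot_castSucc] at hab
        split_ifs at hab
        · obtain rfl : Fin.last n = a := by simpa using hab
          exact absurd hlt (Fin.le_last _).not_gt
        · obtain ⟨a, hba, rfl⟩ : ∃ x, q b = some x ∧ x.castSucc = a := by simpa using hab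
          exact hl a b c hcb hba hlt

theorem attachLeaf_deleteLast {p : Fin (n + 1) → Option (Fin (n + 1))} (hp : IsValleyForest p)
    {w : Fin n} (hw : p (Fin.last n) = some w.castSucc) :
    attachLeaf (deleteLast p) w = p := by
  funext v
  refine Fin.lastCases ?_ (fun v => ?_) v
  · rw [attachLeaf_last, hw]
  · rw [attachLeaf_castSucc]
    have hne : p v.castSucc ≠ some (Fin.last n) := fun h =>
      (hp.2 _ _ _ h hw (Fin.castSucc_lt_last w)).not_gt (Fin.castSucc_lt_last v)
    rcases hv : p v.castSucc with - | u
    · rw [deleteLast_eq_none.2 (Or.inl hv), Option.map_none]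
    · revert hv
      refine Fin.lastCases (fun hv => absurd hv hne) (fun u hv => ?_) u
      rw [deleteLast_eq_some.2 hv, Option.map_some]

theorem attachRoot_deleteLast {p : Fin (n + 1) → Option (Fin (n + 1))}
    (hp : p (Fin.last n) = none) :
    attachRoot (deleteLast p)
      (Finset.univ.filter fun v => p v.castSucc = some (Fin.last n)) = p := by
  funext v
  refine Fin.lastCases ?_ (fun v => ?_) v
  · rw [attachRoot_last, hp]
  · rw [attachRoot_castSucc]
    split_ifs with hS
    · exact (Finset.mem_filter.1 hS).2.symm
    · rcases hv : p v.castSucc with - | u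
      · rw [deleteLast_eq_none.2 (Or.inl hv), Option.map_none]
      · revert hv
        refine Fin.lastCases (fun hv => absurd hv (by simpa using hS)) (fun u hv => ?_) u
        rw [deleteLast_eq_some.2 hv, Option.map_some]

theorem card_rootSet_eq_add (p : Fin (n + 1) → Option (Fin (n + 1))) :
    (rootSet p).card = (Finset.univ.filter fun v : Fin n => p v.castSucc = none).card +
      if p (Fin.last n) = none then 1 else 0 := by
  simp only [rootSet, Finset.card_filter, Fin.sum_univ_castSucc]

theorem card_rootSet_attachLeaf (q : Fin n → Option (Fin n)) (w : Fin n) :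
    (rootSet (attachLeaf q w)).card = (rootSet q).card := by
  rw [card_rootSet_eq_add]
  simp [rootSet]

theorem card_rootSet_attachRoot {q : Fin n → Option (Fin n)} {S : Finset (Fin n)}
    (hS : S ⊆ rootSet q) :
    (rootSet (attachRoot q S)).card = (rootSet q).card - S.card + 1 := by
  rw [card_rootSet_eq_add, if_pos (attachRoot_last q S), ← Finset.card_sdiff_of_subset hS]
  congr 2
  ext v
  by_cases hv : v ∈ S <;> simp [hv, rootSet]

open Classical in
/-- The set of valley forests on `n` vertices. -/
noncomputable def valleyForests (n : ℕ) : Finset (Fin n → Option (Fin n)) :=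
  Finset.univ.filter IsValleyForest

theorem mem_valleyForests {p : Fin n → Option (Fin n)} :
    p ∈ valleyForests n ↔ IsValleyForest p := by
  simp [valleyForests]

theorem sum_valleyForests_last_ne_none (n t : ℕ) :
    ∑ p ∈ valleyForests (n + 1) with p (Fin.last n) ≠ none, t ^ (rootSet p).card =
      n * ∑ q ∈ valleyForests n, t ^ (rootSet q).card := by
  have h : n * ∑ q ∈ valleyForests n, t ^ (rootSet q).card =
      ∑ x ∈ valleyForests n ×ˢ (Finset.univ : Finset (Fin n)), t ^ (rootSet x.1).card := by
    simp [Finset.sum_product, Finset.mul_sum]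
  rw [h]
  symm
  refine Finset.sum_bij (fun x _ => attachLeaf x.1 x.2) ?_ ?_ ?_ ?_
  · rintro ⟨q, w⟩ hx
    simp only [Finset.mem_product, mem_valleyForests, Finset.mem_univ, and_true] at hx
    simp [mem_valleyForests, hx.attachLeaf w]
  · rintro ⟨q, w⟩ - ⟨q', w'⟩ - heq
    have hq := congrArg deleteLast heq
    have hw := congrFun heq (Fin.last n)
    simp only [deleteLast_attachLeaf] at hq
    simp only [attachLeaf_last, Option.some.injEq, Fin.castSucc_inj] at hw
    rw [hq, hw]
  · intro p hp
    rw [Finset.mem_filter, mem_valleyForests] at hp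
    obtain ⟨hp, hlast⟩ := hp
    obtain ⟨u, hu⟩ := Option.ne_none_iff_exists'.1 hlast
    obtain ⟨w, rfl⟩ := Fin.exists_castSucc_eq.2 (hp.1.ne_of_parent hu)
    exact ⟨(deleteLast p, w), by simpa [mem_valleyForests] using hp.deleteLast,
      attachLeaf_deleteLast hp hu⟩
  · rintro ⟨q, w⟩ -
    rw [card_rootSet_attachLeaf]

theorem sum_valleyForests_last_eq_none (n t : ℕ) :
    ∑ p ∈ valleyForests (n + 1) with p (Fin.last n) = none, t ^ (rootSet p).card =
      t * ∑ q ∈ valleyForests n, (t + 1) ^ (rootSet q).card := by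
  have h : t * ∑ q ∈ valleyForests n, (t + 1) ^ (rootSet q).card =
      ∑ x ∈ (valleyForests n).sigma fun q => (rootSet q).powerset,
        t ^ ((rootSet x.1).card - x.2.card + 1) := by
    rw [Finset.sum_sigma, Finset.mul_sum]
    refine Finset.sum_congr rfl fun q _ => ?_
    rw [add_comm t 1, ← Finset.sum_pow_mul_eq_add_pow, Finset.mul_sum]
    refine Finset.sum_congr rfl fun S _ => ?_
    rw [one_pow, one_mul, pow_succ']
  rw [h]
  symm
  refine Finset.sum_bij (fun x _ => attachRoot x.1 x.2) ?_ ?_ ?_ ?_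
  · rintro ⟨q, S⟩ hx
    simp only [Finset.mem_sigma, mem_valleyForests] at hx
    simp [mem_valleyForests, hx.1.attachRoot S]
  · rintro ⟨q, S⟩ hx ⟨q', S'⟩ hx' heq
    simp only [Finset.mem_sigma, Finset.mem_powerset] at hx hx'
    have hq := congrArg deleteLast heq
    simp only [deleteLast_attachRoot hx.2, deleteLast_attachRoot hx'.2] at hq
    subst hq
    have hS : S = S' := by
      ext v
      have hv := congrFun heq v.castSucc
      by_cases h₁ : v ∈ S <;> by_cases h₂ : v ∈ S' <;> simp_all [eq_comm]
    rw [hS]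
  · intro p hp
    rw [Finset.mem_filter, mem_valleyForests] at hp
    refine ⟨⟨deleteLast p, Finset.univ.filter fun v => p v.castSucc = some (Fin.last n)⟩, ?_,
      attachRoot_deleteLast hp.2⟩
    rw [Finset.mem_sigma, mem_valleyForests, Finset.mem_powerset]
    refine ⟨hp.1.deleteLast, fun v hv => ?_⟩
    exact Finset.mem_filter.2 ⟨Finset.mem_univ v,
      deleteLast_eq_none.2 (Or.inr (Finset.mem_filter.1 hv).2)⟩
  · rintro ⟨q, S⟩ hx
    simp only [Finset.mem_sigma, Finset.mem_powerset] at hx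
    rw [card_rootSet_attachRoot hx.2]

theorem sum_valleyForests_pow_card_rootSet (n t : ℕ) :
    ∑ p ∈ valleyForests n, t ^ (rootSet p).card =
      ∑ π : Equiv.Perm (Fin n), t.ascFactorial (permNumCycles π) := by
  induction n generalizing t with
  | zero =>
    have huniv : valleyForests 0 = Finset.univ := by
      ext p
      simp only [mem_valleyForests, Finset.mem_univ, iff_true]
      exact ⟨⟨fun _ => 0, fun v => v.elim0⟩, fun a => a.elim0⟩
    simp [huniv, rootSet, permNumCycles]
  | succ n ih =>
    rw [← Finset.sum_filter_add_sum_filter_not _ fun p => p (Fin.last n) = none,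
      sum_valleyForests_last_eq_none, sum_valleyForests_last_ne_none, ih, ih,
      sum_ascFactorial_permNumCycles_succ, add_comm]

end Forests

theorem count_reverse_unimodal_forests (n : ℕ) (hn : 1 ≤ n) :
    Nat.card {p : Fin n → Option (Fin n) //
        IsForest p ∧ ForestAvoids p [1, 3, 2] ∧ ForestAvoids p [2, 3, 1]} =
    ∑ k ∈ Finset.Icc 1 n, k.factorial * stirlingFirst n k := by
  classical
  have h := sum_valleyForests_pow_card_rootSet n 1
  simp only [one_pow, Nat.one_ascFactorial, Finset.sum_const, smul_eq_mul, mul_one] at h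
  rw [← sum_factorial_permNumCycles hn, ← h, Nat.card_eq_fintype_card, Fintype.card_subtype]
  congr 1
  ext p
  rw [mem_valleyForests, isValleyForest_iff, Finset.mem_filter]
  simp
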